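/- There is no Borel ideal I on ℕ such that T₂ is Borel bireducible with E_I (i.e., such that both T₂ ≤B E_I and E_I ≤B T₂ hold). -/

import Mathlib

open MeasureTheory

/-- Borel reducibility: a Borel-measurable map `θ` with `E x x' ↔ F (θ x) (θ x')`. -/
def BorelReducible {X Y : Type*} [TopologicalSpace X] [TopologicalSpace Y]
    (E : X → X → Prop) (F : Y → Y → Prop) : Prop :=
  ∃ θ : X → Y, @Measurable X Y (borel X) (borel Y) θ ∧
    ∀ x x' : X, E x x' ↔ F (θ x) (θ x')

/-- An ideal on `ℕ`, with subsets of `ℕ` identified with their characteristic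
functions in Cantor space: contains `∅`, closed under subsets and (finite) unions. -/
def IsIdeal (I : Set (ℕ → Bool)) : Prop :=
  (fun _ => false) ∈ I ∧
  (∀ x y : ℕ → Bool, y ∈ I → (∀ n, x n = true → y n = true) → x ∈ I) ∧
  (∀ x y : ℕ → Bool, x ∈ I → y ∈ I → (fun n => x n || y n) ∈ I)

/-- The equivalence relation induced by an ideal: `x ∼ y` iff `x Δ y ∈ I`. -/
def EI (I : Set (ℕ → Bool)) (x y : ℕ → Bool) : Prop := (fun n => x n != y n) ∈ I

/-- `T₂`, the equality of countable sets of reals: `x ∼ y` iff `x` and `y`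
(as sequences of elements of Baire space) have the same range. -/
def T2 (x y : ℕ → ℕ → ℕ) : Prop := Set.range x = Set.range y

open Set Filter Topology TopologicalSpace

section Category

variable {X : Type*} [TopologicalSpace X]

/-- A Borel map into a second countable space is continuous on a comeagre set. -/
theorem exists_mem_residual_continuousOn {Y : Type*} [TopologicalSpace Y]
    [SecondCountableTopology Y] {f : X → Y}
    (hf : @Measurable X Y (borel X) (borel Y) f) :
    ∃ C ∈ residual X, ContinuousOn f C := by
  borelize X Y
  have key : ∀ V : countableBasis Y, ∃ O, IsOpen O ∧ f ⁻¹' (V : Set Y) =ᵇ O := fun V =>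
    (hf (isOpen_of_mem_countableBasis V.2).measurableSet).residualEq_isOpen
  choose O hO hfO using key
  refine ⟨{x | ∀ V : countableBasis Y, x ∈ f ⁻¹' (V : Set Y) ↔ x ∈ O V}, ?_, ?_⟩
  · exact eventually_countable_forall.2 fun V => (hfO V).mem_iff
  · refine continuousOn_iff'.2 fun t ht => ?_
    refine ⟨⋃ V : {V : countableBasis Y // (V : Set Y) ⊆ t}, O V.1,
      isOpen_iUnion fun V => hO V.1, ?_⟩
    ext x
    simp only [mem_inter_iff, mem_preimage, mem_iUnion, and_congr_left_iff]
    intro hx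
    constructor
    · intro hxt
      obtain ⟨V, hV, hxV, hVt⟩ := (isBasis_countableBasis Y).exists_subset_of_mem_open hxt ht
      exact ⟨⟨⟨V, hV⟩, hVt⟩, (hx ⟨V, hV⟩).1 hxV⟩
    · rintro ⟨V, hV⟩
      exact V.2 ((hx V.1).2 hV)

/-- A Baire measurable set which is nonmeagre in an open set is comeagre in a basic open subset. -/
theorem BaireMeasurableSet.exists_mem_countableBasis [SecondCountableTopology X] {S O : Set X}
    (hS : BaireMeasurableSet S) (hO : IsOpen O)
    (h : ¬ ∀ᶠ x in residual X, x ∈ O → x ∉ S) :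
    ∃ V ∈ countableBasis X, V ⊆ O ∧ ∀ᶠ x in residual X, x ∈ V → x ∈ S := by
  obtain ⟨W, hW, hSW⟩ := hS.residualEq_isOpen
  have hne : (O ∩ W).Nonempty := by
    by_contra hne
    refine h (hSW.mem_iff.mono fun x hx hxO hxS => hne ⟨x, hxO, hx.1 hxS⟩)
  obtain ⟨x, hx⟩ := hne
  obtain ⟨V, hV, -, hVO⟩ :=
    (isBasis_countableBasis X).exists_subset_of_mem_open hx (hO.inter hW)
  exact ⟨V, hV, fun y hy => (hVO hy).1, hSW.mem_iff.mono fun y hy hyV => hy.2 (hVO hyV).2⟩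

end Category

section SymmetricDifference

/-- Symmetric difference in Cantor space. -/
def cantorXor (x y : ℕ → Bool) : ℕ → Bool := fun n => x n != y n

theorem cantorXor_assoc (x y z : ℕ → Bool) :
    cantorXor (cantorXor x y) z = cantorXor x (cantorXor y z) := by
  funext n; simp [cantorXor]

theorem cantorXor_cancel_left (x y : ℕ → Bool) : cantorXor x (cantorXor x y) = y := by
  funext n; simp [cantorXor]

theorem cantorXor_cancel_right (x y : ℕ → Bool) : cantorXor (cantorXor x y) y = x := by
  funext n; simp [cantorXor]

theorem continuous_cantorXor : Continuous fun p : (ℕ → Bool) × (ℕ → Bool) =>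
    cantorXor p.1 p.2 := by
  refine continuous_pi fun n => ?_
  exact (continuous_of_discreteTopology (f := fun b : Bool × Bool => b.1 != b.2)).comp
    (by fun_prop : Continuous fun p : (ℕ → Bool) × (ℕ → Bool) => (p.1 n, p.2 n))

/-- Translation by a point of Cantor space. -/
def cantorTranslate (x : ℕ → Bool) : (ℕ → Bool) ≃ₜ (ℕ → Bool) where
  toFun := cantorXor x
  invFun := cantorXor x
  left_inv := cantorXor_cancel_left x
  right_inv := cantorXor_cancel_left x
  continuous_toFun := continuous_cantorXor.comp (by fun_prop : Continuous fun y => (x, y))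
  continuous_invFun := continuous_cantorXor.comp (by fun_prop : Continuous fun y => (x, y))

theorem eventually_residual_cantorXor {p : (ℕ → Bool) → Prop} (x : ℕ → Bool)
    (h : ∀ᶠ y in residual (ℕ → Bool), p y) :
    ∀ᶠ y in residual (ℕ → Bool), p (cantorXor x y) :=
  (tendsto_residual_of_isOpenMap (cantorTranslate x).continuous
    (cantorTranslate x).isOpenMap).eventually h

end SymmetricDifference

section Separation

variable {I : Set (ℕ → Bool)} {ψ : (ℕ → Bool) → ℕ → ℕ → ℕ}

/-- The points `x` such that `ψ y k` is listed by `ψ (x Δ y)` for nonmeagrely many `y ∈ O`. -/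
def listedSet (ψ : (ℕ → Bool) → ℕ → ℕ → ℕ) (k : ℕ) (O : Set (ℕ → Bool)) : Set (ℕ → Bool) :=
  {x | ¬ ∀ᶠ y in residual (ℕ → Bool), y ∈ O → ψ y k ∉ range (ψ (cantorXor x y))}

/-- The points `x` such that `ψ y k` is the `l`-th entry of `ψ (x Δ y)` for generic `y ∈ V`. -/
def listedPiece (ψ : (ℕ → Bool) → ℕ → ℕ → ℕ) (k : ℕ) (V : Set (ℕ → Bool)) (l : ℕ) :
    Set (ℕ → Bool) :=
  {x | ∀ᶠ y in residual (ℕ → Bool), y ∈ V → ψ y k = ψ (cantorXor x y) l}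

theorem baireMeasurableSet_listed
    (hψ : @Measurable _ _ (borel (ℕ → Bool)) (borel (ℕ → ℕ → ℕ)) ψ) (k l : ℕ) (x : ℕ → Bool) :
    BaireMeasurableSet {y | ψ y k = ψ (cantorXor x y) l} := by
  have hB : (inferInstance : MeasurableSpace (ℕ → Bool)) = borel _ := BorelSpace.measurable_eq
  have hB' : (inferInstance : MeasurableSpace (ℕ → ℕ → ℕ)) = borel _ := BorelSpace.measurable_eq
  have hm : Measurable ψ := by
    rw [← hB, ← hB'] at hψ
    exact hψ
  have h1 : Measurable fun y => ψ y k := (measurable_pi_apply k).comp hm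
  have h2 : Measurable fun y => ψ (cantorXor x y) l :=
    (measurable_pi_apply l).comp (hm.comp (cantorTranslate x).continuous.measurable)
  exact (measurableSet_eq_fun h1 h2).baireMeasurableSet

theorem isClosed_listedPiece
    (hψ : @Measurable _ _ (borel (ℕ → Bool)) (borel (ℕ → ℕ → ℕ)) ψ)
    (k : ℕ) (V : Set (ℕ → Bool)) (l : ℕ) : IsClosed (listedPiece ψ k V l) := by
  obtain ⟨C, hC, hψC⟩ := exists_mem_residual_continuousOn hψ
  refine IsSeqClosed.isClosed fun u x hu hux => ?_
  have h1 : ∀ᶠ y in residual (ℕ → Bool), ∀ j, y ∈ V → ψ y k = ψ (cantorXor (u j) y) l :=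
    eventually_countable_forall.2 hu
  have h2 := eventually_countable_forall.2 fun j => eventually_residual_cantorXor (u j) hC
  filter_upwards [h1, h2, eventually_residual_cantorXor x hC] with y hy hyC hyx hyV
  have hlim : Tendsto (fun j => cantorXor (u j) y) atTop (𝓝[C] (cantorXor x y)) := by
    refine tendsto_nhdsWithin_iff.2 ⟨?_, Eventually.of_forall hyC⟩
    exact (continuous_cantorXor.tendsto (x, y)).comp (hux.prodMk_nhds tendsto_const_nhds)
  have hlim' := ((continuous_apply l).tendsto _).comp ((hψC _ hyx).tendsto.comp hlim)
  refine tendsto_nhds_unique tendsto_const_nhds (hlim'.congr fun j => ?_)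
  exact (hy j hyV).symm

theorem exists_mem_listedPiece
    (hψ : @Measurable _ _ (borel (ℕ → Bool)) (borel (ℕ → ℕ → ℕ)) ψ) {k : ℕ}
    {O : Set (ℕ → Bool)} (hO : IsOpen O) {x : ℕ → Bool} (hx : x ∈ listedSet ψ k O) :
    ∃ V ∈ countableBasis (ℕ → Bool), V ⊆ O ∧ ∃ l, x ∈ listedPiece ψ k V l := by
  have : ∃ l, ¬ ∀ᶠ y in residual (ℕ → Bool), y ∈ O → y ∉ {y | ψ y k = ψ (cantorXor x y) l} := by
    by_contra! h
    refine hx ((eventually_countable_forall.2 h).mono ?_)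
    rintro y hy hyO ⟨l, hl⟩
    exact hy l hyO hl.symm
  obtain ⟨l, hl⟩ := this
  obtain ⟨V, hV, hVO, h⟩ := (baireMeasurableSet_listed hψ k l x).exists_mem_countableBasis hO hl
  exact ⟨V, hV, hVO, l, h⟩

theorem listedPiece_subset {k l : ℕ} {O V : Set (ℕ → Bool)}
    (hV : V ∈ countableBasis (ℕ → Bool)) (hVO : V ⊆ O) :
    listedPiece ψ k V l ⊆ listedSet ψ k O := by
  intro x hx h
  refine not_isMeagre_of_isOpen (isOpen_of_mem_countableBasis hV)
    (nonempty_of_mem_countableBasis hV) ?_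
  filter_upwards [h, hx] with y hy hy' hyV
  exact hy (hVO hyV) ⟨l, (hy' hyV).symm⟩

theorem cantorXor_mem_listedSet (hred : ∀ x y, cantorXor x y ∈ I ↔ range (ψ x) = range (ψ y))
    {k : ℕ} {O : Set (ℕ → Bool)} {x z : ℕ → Bool} (hz : z ∈ I) (hx : x ∈ listedSet ψ k O) :
    cantorXor z x ∈ listedSet ψ k O := by
  intro h
  refine hx (h.mono fun y hy hyO => ?_)
  have : range (ψ (cantorXor (cantorXor z x) y)) = range (ψ (cantorXor x y)) := by
    refine (hred _ _).1 ?_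
    rwa [cantorXor_assoc z, cantorXor_cancel_right]
  rw [← this]
  exact hy hyO

/-- If `E_I` reduces to `T₂` through `ψ`, then `I` is the intersection of the sets `listedSet`. -/
theorem mem_iff_forall_mem_listedSet
    (hψ : @Measurable _ _ (borel (ℕ → Bool)) (borel (ℕ → ℕ → ℕ)) ψ)
    (hred : ∀ x y, cantorXor x y ∈ I ↔ range (ψ x) = range (ψ y)) (x : ℕ → Bool) :
    x ∈ I ↔ ∀ k, ∀ O ∈ countableBasis (ℕ → Bool), x ∈ listedSet ψ k O := by
  constructor
  · intro hx k O hO h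
    refine not_isMeagre_of_isOpen (isOpen_of_mem_countableBasis hO)
      (nonempty_of_mem_countableBasis hO) ?_
    filter_upwards [h] with y hy hyO
    have : range (ψ (cantorXor x y)) = range (ψ y) :=
      (hred _ _).1 (by rwa [cantorXor_cancel_right])
    exact hy hyO (this ▸ mem_range_self k)
  · intro h
    have hgen : ∀ k, ∀ᶠ y in residual (ℕ → Bool), ψ y k ∈ range (ψ (cantorXor x y)) := by
      intro k
      by_contra hk
      have hS : BaireMeasurableSet {y | ψ y k ∈ range (ψ (cantorXor x y))}ᶜ := by
        have := BaireMeasurableSet.iUnion fun l => baireMeasurableSet_listed hψ k l x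
        refine BaireMeasurableSet.compl ?_
        convert this using 1
        ext y
        simp [eq_comm]
      obtain ⟨V, hV, -, hVS⟩ := hS.exists_mem_countableBasis isOpen_univ
        (by simpa using hk)
      exact h k V hV hVS
    have hgen' := eventually_countable_forall.2 hgen
    obtain ⟨y, hy, hy'⟩ := (dense_of_mem_residual
      (hgen'.and (eventually_residual_cantorXor x hgen'))).nonempty
    rw [← cantorXor_cancel_right x y, hred]
    refine Subset.antisymm ?_ (range_subset_iff.2 hy)
    simpa only [cantorXor_cancel_left] using range_subset_iff.2 hy'

end Separation

section DiscreteSequences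

variable {A : Type*}

/-- Replace the sequence `f` by the concatenation of the first `N` terms of `s` with `f`. -/
def prependSeq (s : ℕ → A) (N : ℕ) (f : ℕ → A) : ℕ → A :=
  fun i => if i < N then s i else f (i - N)

theorem range_prependSeq {s f : ℕ → A} {N : ℕ} (h : ∀ i < N, s i ∈ range f) :
    range (prependSeq s N f) = range f := by
  refine Subset.antisymm (range_subset_iff.2 fun i => ?_) (range_subset_iff.2 fun i => ?_)
  · unfold prependSeq
    split_ifs with hi
    exacts [h i hi, mem_range_self _]
  · exact ⟨i + N, by simp [prependSeq]⟩

variable [TopologicalSpace A]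

theorem exists_prependSeq_mem {U : Set (ℕ → A)} (hU : IsOpen U) {s : ℕ → A} (hs : s ∈ U) :
    ∃ N, ∀ f, prependSeq s N f ∈ U := by
  obtain ⟨J, u, hu, hJU⟩ := isOpen_pi_iff.1 hU s hs
  refine ⟨J.sup id + 1, fun f => hJU fun i hi => ?_⟩
  have : i < J.sup id + 1 := Nat.lt_succ_of_le (Finset.le_sup (f := id) hi)
  simpa [prependSeq, this] using (hu i hi).2

/-- A set of sequences which meets every cylinder is dense. -/
theorem dense_of_forall_prependSeq {S : Set (ℕ → A)}
    (h : ∀ (s : ℕ → A) N, ∃ f, prependSeq s N f ∈ S) : Dense S := by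
  refine dense_iff_inter_open.2 fun U hU ⟨s, hs⟩ => ?_
  obtain ⟨N, hN⟩ := exists_prependSeq_mem hU hs
  obtain ⟨f, hf⟩ := h s N
  exact ⟨_, hN f, hf⟩

variable [DiscreteTopology A]

theorem eventually_residual_prependSeq (s : ℕ → A) (N : ℕ) {p : (ℕ → A) → Prop}
    (h : ∀ᶠ f in residual (ℕ → A), p f) :
    ∀ᶠ f in residual (ℕ → A), p (prependSeq s N f) := by
  refine (tendsto_residual_of_isOpenMap ?_ ?_).eventually h
  · refine continuous_pi fun i => ?_
    unfold prependSeq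
    split_ifs <;> fun_prop
  · intro W hW
    have : prependSeq s N '' W =
        (⋂ i ∈ Finset.range N, {h : ℕ → A | h i = s i}) ∩ (fun h i => h (i + N)) ⁻¹' W := by
      ext h
      simp only [mem_image, mem_inter_iff, mem_iInter, Finset.mem_range, mem_ofPred_eq,
        mem_preimage]
      constructor
      · rintro ⟨f, hf, rfl⟩
        exact ⟨fun i hi => by simp [prependSeq, hi], by simpa [prependSeq] using hf⟩
      · rintro ⟨h1, h2⟩
        refine ⟨_, h2, funext fun i => ?_⟩
        unfold prependSeq
        split_ifs with hi
        · exact (h1 i hi).symm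
        · simp [Nat.sub_add_cancel (not_lt.1 hi)]
    rw [this]
    refine IsOpen.inter (isOpen_biInter_finset fun i _ => ?_) (hW.preimage (by fun_prop))
    exact (isOpen_discrete ({s i} : Set A)).preimage (continuous_apply (A := fun _ => A) i)

theorem isOpen_mem_range (a : A) : IsOpen {f : ℕ → A | a ∈ range f} := by
  have : {f : ℕ → A | a ∈ range f} = ⋃ i, (fun f : ℕ → A => f i) ⁻¹' {a} := by
    ext f; simp
  rw [this]
  exact isOpen_iUnion fun i => (isOpen_discrete _).preimage (continuous_apply i)

theorem eventually_residual_mem_range (a : A) : ∀ᶠ f in residual (ℕ → A), a ∈ range f := by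
  refine residual_of_dense_open (isOpen_mem_range a) (dense_of_forall_prependSeq fun s N => ?_)
  exact ⟨fun _ => a, N, by simp [prependSeq]⟩

theorem eventually_residual_not_range_subset [Uncountable A] (g : ℕ → A) :
    ∀ᶠ f in residual (ℕ → A), ¬ range f ⊆ range g := by
  obtain ⟨a, ha⟩ : ∃ a, a ∉ range g := by
    by_contra! h
    exact not_countable_univ ((countable_range g).mono fun a _ => h a)
  exact (eventually_residual_mem_range a).mono fun f hf hfg => ha (hfg hf)

/-- Mutually generic sequences have the same range. -/
theorem eventually_residual_range_eq :
    ∀ᶠ p in residual ((ℕ → A) × (ℕ → A)), range p.1 = range p.2 := by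
  have key : ∀ k, ∀ᶠ p in residual ((ℕ → A) × (ℕ → A)), p.1 k ∈ range p.2 := by
    intro k
    refine residual_of_dense_open ?_ ?_
    · have : {p : (ℕ → A) × (ℕ → A) | p.1 k ∈ range p.2} =
          ⋃ l, {p | p.1 k = p.2 l} := by ext p; simp [eq_comm]
      change IsOpen {p : (ℕ → A) × (ℕ → A) | p.1 k ∈ range p.2}
      rw [this]
      refine isOpen_iUnion fun l => ?_
      exact (isOpen_discrete {q : A × A | q.1 = q.2}).preimage
        (by fun_prop : Continuous fun p : (ℕ → A) × (ℕ → A) => (p.1 k, p.2 l))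
    · refine dense_iff_inter_open.2 fun W hW ⟨p, hp⟩ => ?_
      obtain ⟨U, V, -, hV, hpU, hpV, hUV⟩ := isOpen_prod_iff.1 hW p.1 p.2 hp
      obtain ⟨N, hN⟩ := exists_prependSeq_mem hV hpV
      exact ⟨(p.1, prependSeq p.2 N p.1), hUV ⟨hpU, hN _⟩, k + N, by simp [prependSeq]⟩
  have hswap : ∀ k, ∀ᶠ p in residual ((ℕ → A) × (ℕ → A)), p.2 k ∈ range p.1 := fun k =>
    (tendsto_residual_of_isOpenMap continuous_swap
      (Homeomorph.prodComm (ℕ → A) (ℕ → A)).isOpenMap).eventually (key k)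
  filter_upwards [eventually_countable_forall.2 key, eventually_countable_forall.2 hswap]
    with p h1 h2
  exact Subset.antisymm (range_subset_iff.2 h1) (range_subset_iff.2 h2)

/-- If `I` is a countable intersection of `I`-invariant `F_σ` sets, then equality of ranges of
sequences in an uncountable discrete space does not reduce to `E_I`. -/
theorem false_of_reduction_range [Uncountable A] {I : Set (ℕ → Bool)} {ι κ : Type*}
    [Countable ι] [Countable κ] {F : ι → Set (ℕ → Bool)} {K : ι → κ → Set (ℕ → Bool)}
    (hF : ∀ i, F i = ⋃ m, K i m) (hK : ∀ i m, IsClosed (K i m))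
    (hI : ∀ x, x ∈ I ↔ ∀ i, x ∈ F i)
    (hinv : ∀ i x z, z ∈ I → x ∈ F i → cantorXor z x ∈ F i)
    {θ : (ℕ → A) → ℕ → Bool} {C : Set (ℕ → A)} (hC : C ∈ residual (ℕ → A))
    (hθ : ContinuousOn θ C)
    (hred : ∀ f g, range f = range g ↔ cantorXor (θ f) (θ g) ∈ I) : False := by
  let d : (ℕ → A) × (ℕ → A) → ℕ → Bool := fun p => cantorXor (θ p.1) (θ p.2)
  have hd : ContinuousOn d (C ×ˢ C) := continuous_cantorXor.comp_continuousOn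
    ((hθ.comp continuousOn_fst fun p hp => hp.1).prodMk
      (hθ.comp continuousOn_snd fun p hp => hp.2))
  have hCC : C ×ˢ C ∈ residual ((ℕ → A) × (ℕ → A)) := inter_mem
    (tendsto_residual_of_isOpenMap continuous_fst isOpenMap_fst hC)
    (tendsto_residual_of_isOpenMap continuous_snd isOpenMap_snd hC)
  let good : ι → Set (Set (ℕ → A)) := fun i => {V | IsOpen V ∧ ∃ U, IsOpen U ∧ U.Nonempty ∧
    ∀ f ∈ U ∩ C, ∀ g ∈ V ∩ C, d (f, g) ∈ F i}
  have hgood : ∀ i, ∀ᶠ g in residual (ℕ → A), g ∈ ⋃₀ good i := by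
    intro i
    refine residual_of_dense_open (isOpen_sUnion fun V hV => hV.1) ?_
    refine dense_iff_inter_open.2 fun V hV hVne => ?_
    obtain ⟨R, hR, hRδ, hRd⟩ := mem_residual.1
      (inter_mem hCC (eventually_residual_range_eq (A := A)))
    have hcover : R ⊆ ⋃ m, closure (C ×ˢ C ∩ d ⁻¹' K i m) := by
      intro p hp
      have hpi : d p ∈ F i := (hI _).1 ((hred _ _).1 (hR hp).2) i
      rw [hF] at hpi
      obtain ⟨m, hm⟩ := mem_iUnion.1 hpi
      exact mem_iUnion.2 ⟨m, subset_closure ⟨(hR hp).1, hm⟩⟩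
    have hdense := hRδ.dense_iUnion_interior_of_closed hRd (fun m => isClosed_closure) hcover
    obtain ⟨g₀, hg₀⟩ := hVne
    obtain ⟨p, hpV, hp⟩ := hdense.inter_open_nonempty (univ ×ˢ V) (isOpen_univ.prod hV)
      ⟨(g₀, g₀), trivial, hg₀⟩
    obtain ⟨m, hm⟩ := mem_iUnion.1 hp
    obtain ⟨U, W, hU, hW, hpU, hpW, hUW⟩ := isOpen_prod_iff.1 isOpen_interior p.1 p.2 hm
    refine ⟨p.2, hpV.2, mem_sUnion.2 ⟨W, ⟨hW, U, hU, ⟨p.1, hpU⟩, ?_⟩, hpW⟩⟩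
    intro f hf g hg
    have hcl : (f, g) ∈ closure (C ×ˢ C ∩ d ⁻¹' K i m) := interior_subset (hUW ⟨hf.1, hg.1⟩)
    have hmem := ((hd (f, g) ⟨hf.2, hg.2⟩).mono inter_subset_left).mem_closure hcl
      (t := K i m) fun q hq => hq.2
    rw [(hK i m).closure_eq] at hmem
    rw [hF]
    exact mem_iUnion.2 ⟨m, hmem⟩
  obtain ⟨g, hgC, hg⟩ :=
    (dense_of_mem_residual (inter_mem hC (eventually_countable_forall.2 hgood))).nonempty
  have hstem : ∀ i, ∃ (s : ℕ → A) (N : ℕ), ∀ f, prependSeq s N f ∈ C →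
      d (prependSeq s N f, g) ∈ F i := by
    intro i
    obtain ⟨V, ⟨-, U, hU, ⟨s, hs⟩, hUV⟩, hgV⟩ := mem_sUnion.1 (hg i)
    obtain ⟨N, hN⟩ := exists_prependSeq_mem hU hs
    exact ⟨s, N, fun f hf => hUV _ ⟨hN f, hf⟩ g ⟨hgV, hgC⟩⟩
  choose s N hsN using hstem
  have h1 : ∀ᶠ f in residual (ℕ → A), ∀ i, prependSeq (s i) (N i) f ∈ C :=
    eventually_countable_forall.2 fun i => eventually_residual_prependSeq _ _ hC
  have h2 : ∀ᶠ f in residual (ℕ → A), ∀ i j, s i j ∈ range f :=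
    eventually_countable_forall.2 fun i => eventually_countable_forall.2 fun j =>
      eventually_residual_mem_range _
  obtain ⟨f, ⟨hf1, hf2⟩, hf3⟩ := (dense_of_mem_residual
    ((h1.and h2).and (eventually_residual_not_range_subset g))).nonempty
  refine hf3 ((hred f g).2 ((hI _).2 fun i => ?_)).subset
  have hequiv : cantorXor (θ f) (θ (prependSeq (s i) (N i) f)) ∈ I :=
    (hred _ _).1 (range_prependSeq fun j _ => hf2 i j).symm
  have := hinv i _ _ hequiv (hsN i f (hf1 i))
  rwa [cantorXor_assoc, cantorXor_cancel_left] at this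

end DiscreteSequences

/-- Baire space with the discrete topology. -/
def DiscreteBaire : Type := ℕ → ℕ

instance : TopologicalSpace DiscreteBaire := ⊥

instance : DiscreteTopology DiscreteBaire := ⟨rfl⟩

instance : Uncountable DiscreteBaire := by
  refine ⟨fun (_ : Countable (ℕ → ℕ)) => ?_⟩
  obtain ⟨e, he⟩ := exists_surjective_nat (ℕ → ℕ)
  obtain ⟨n, hn⟩ := he fun n => e n n + 1
  exact absurd (congrFun hn n) (Nat.lt_succ_self _).ne

/-- The identity map to Baire space. -/
def DiscreteBaire.toBaire (a : DiscreteBaire) : ℕ → ℕ := a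

/-- there is no Borel ideal `I` on `ℕ` with `T₂` Borel bireducible
with `E_I`. -/
theorem T2_not_bireducible_with_ideal :
    ¬ ∃ I : Set (ℕ → Bool), IsIdeal I ∧ MeasurableSet[borel (ℕ → Bool)] I ∧
      BorelReducible T2 (EI I) ∧ BorelReducible (EI I) T2 := by
  rintro ⟨I, -, -, ⟨θ, hθ, hθred⟩, ψ, hψ, hψred⟩
  have hψred' : ∀ x y, cantorXor x y ∈ I ↔ range (ψ x) = range (ψ y) := hψred
  have hcont : Continuous fun (f : ℕ → DiscreteBaire) i => DiscreteBaire.toBaire (f i) :=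
    continuous_pi fun i => (continuous_of_discreteTopology (f := DiscreteBaire.toBaire)).comp
      (continuous_apply i)
  obtain ⟨C, hC, hθC⟩ := exists_mem_residual_continuousOn (hθ.comp hcont.borel_measurable)
  refine false_of_reduction_range (A := DiscreteBaire) (I := I)
    (ι := ℕ × countableBasis (ℕ → Bool)) (κ := countableBasis (ℕ → Bool) × ℕ)
    (F := fun i => listedSet ψ i.1 i.2)
    (K := fun i m => {x | (m.1 : Set (ℕ → Bool)) ⊆ i.2 ∧ x ∈ listedPiece ψ i.1 m.1 m.2})
    ?_ ?_ ?_ ?_ hC hθC fun f g => hθred f g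
  · rintro ⟨k, O⟩
    ext x
    simp only [mem_iUnion, Prod.exists, mem_ofPred_eq]
    constructor
    · intro hx
      obtain ⟨V, hV, hVO, l, hl⟩ :=
        exists_mem_listedPiece hψ (isOpen_of_mem_countableBasis O.2) hx
      exact ⟨⟨V, hV⟩, l, hVO, hl⟩
    · rintro ⟨V, l, hVO, hx⟩
      exact listedPiece_subset V.2 hVO hx
  · exact fun i m => isClosed_const.and (isClosed_listedPiece hψ _ _ _)
  · intro x
    rw [mem_iff_forall_mem_listedSet hψ hψred']
    exact ⟨fun h i => h i.1 i.2 i.2.2, fun h k O hO => h (k, ⟨O, hO⟩)⟩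
  · exact fun i x z hz hx => cantorXor_mem_listedSet hψred' hz hx
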